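/- Let s ∈ ℕ and let P = Σ c_{(α₀,α₁,α₂)} x₀^{α₀}x₁^{α₁}x₂^{α₂} ∈ 𝓗 be homogeneous of total degree 3(1+s). Then for every multi-index (α₀,α₁,α₂) with c_{(α₀,α₁,α₂)} ≠ 0 there exist nonnegative integers s', s'', s''' such that α₀+α₁+α₂ = 3(1+s), α₁+2α₂ = 3s', α₀+2α₁ = 3s'', and 2α₀+α₂ = 3s'''. -/

import Mathlib

open MvPolynomial

/-- The primitive cube root of unity `ε = e^{2πi/3}`. -/
noncomputable def eps3 : ℂ := Complex.exp (2 * Real.pi * Complex.I / 3)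

/-- The algebra automorphism `σ` of `ℂ[x₀,x₁,x₂]` with `σ(x_i) = x_{i+1 mod 3}`. -/
noncomputable def sigma3 : MvPolynomial (Fin 3) ℂ →ₐ[ℂ] MvPolynomial (Fin 3) ℂ :=
  rename (fun i : Fin 3 => i + 1)

/-- The algebra endomorphism `τ` of `ℂ[x₀,x₁,x₂]` with `τ(x_i) = ε^i x_i`. -/
noncomputable def tau3 : MvPolynomial (Fin 3) ℂ →ₐ[ℂ] MvPolynomial (Fin 3) ℂ :=
  aeval (fun i : Fin 3 => C (eps3 ^ (i : ℕ)) * X i)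

/-- The Jacobian Poisson bracket `{x_i, x_j}` attached to the Casimir `P`:
for `(i,j,k)` a cyclic permutation of `(0,1,2)` one has `{x_i,x_j} = ∂P/∂x_k`,
extended antisymmetrically. -/
noncomputable def jb3 (P : MvPolynomial (Fin 3) ℂ) (i j : Fin 3) : MvPolynomial (Fin 3) ℂ :=
  if i = j then 0 else if j = i + 1 then pderiv (i + 2) P else -(pderiv (j + 2) P)

/-- `P ∈ 𝓗`: the Jacobian Poisson structure `π(P)` is Heisenberg-invariant. -/
def Hinv3 (P : MvPolynomial (Fin 3) ℂ) : Prop :=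
  ∀ i j : Fin 3,
    jb3 P (i + 1) (j + 1) = sigma3 (jb3 P i j) ∧
    tau3 (jb3 P i j) = eps3 ^ ((i : ℕ) + (j : ℕ)) • jb3 P i j

theorem isPrimitiveRoot_eps3 : IsPrimitiveRoot eps3 3 := by
  simpa [eps3] using Complex.isPrimitiveRoot_exp 3 (by norm_num)

theorem coeff_tau3 (Q : MvPolynomial (Fin 3) ℂ) (n : Fin 3 →₀ ℕ) :
    coeff n (tau3 Q) = eps3 ^ (n 1 + 2 * n 2) * coeff n Q := by
  induction Q using MvPolynomial.induction_on' with
  | monomial u a =>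
    have h : tau3 (monomial u a) = monomial u (eps3 ^ (u 1 + 2 * u 2) * a) := by
      rw [tau3, aeval_monomial, Finsupp.prod_fintype _ _ (by simp), monomial_eq,
        Finsupp.prod_fintype _ _ (by simp)]
      simp only [Fin.prod_univ_three, algebraMap_eq, map_mul, map_pow, mul_pow, Fin.val_zero,
        Fin.val_one, Fin.val_two]
      ring
    rw [h, coeff_monomial, coeff_monomial]
    split_ifs with hu
    · rw [hu]
    · simp
  | add p q hp hq => rw [map_add, coeff_add, coeff_add, hp, hq, mul_add]

theorem coeff_pderiv_ne_zero {P : MvPolynomial (Fin 3) ℂ} {n : Fin 3 →₀ ℕ} {k : Fin 3}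
    (h : coeff (n + Finsupp.single k 1) P ≠ 0) : coeff n (pderiv k P) ≠ 0 := by
  rw [coeff_pderiv]
  exact mul_ne_zero h (Nat.cast_add_one_ne_zero _)

/-- If `∂P/∂x_k` is a `τ`-eigenvector of eigenvalue `ε ^ r`, then the `τ`-weight of each monomial of
`P` involving `x_k` is `r + k` modulo `3`. -/
theorem weight_modEq_of_tau3_pderiv {P : MvPolynomial (Fin 3) ℂ} {k : Fin 3} {r : ℕ}
    (h : tau3 (pderiv k P) = eps3 ^ r • pderiv k P) {m : Fin 3 →₀ ℕ} (hm : coeff m P ≠ 0)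
    (hk : m k ≠ 0) : m 1 + 2 * m 2 ≡ r + k [MOD 3] := by
  obtain ⟨n, rfl⟩ : ∃ n, m = n + Finsupp.single k 1 :=
    ⟨m - Finsupp.single k 1, (tsub_add_cancel_of_le
      (Finsupp.single_le_iff.2 (Nat.one_le_iff_ne_zero.2 hk))).symm⟩
  have hc := congrArg (coeff n) h
  rw [coeff_tau3, coeff_smul, smul_eq_mul] at hc
  have hp := mul_right_cancel₀ (coeff_pderiv_ne_zero hm) hc
  have hn := (isPrimitiveRoot_eps3.isOfFinOrder (by norm_num)).pow_eq_pow_iff_modEq.1 hp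
  rw [← isPrimitiveRoot_eps3.eq_orderOf] at hn
  have hw : (n + Finsupp.single k 1 : Fin 3 →₀ ℕ) 1 + 2 * (n + Finsupp.single k 1 : Fin 3 →₀ ℕ) 2 =
      n 1 + 2 * n 2 + k := by
    fin_cases k <;> simp <;> ring
  rw [hw]
  exact hn.add_right _

/-- if `P ∈ 𝓗` is homogeneous of degree `3(1+s)`, every exponent multi-index
`(α₀,α₁,α₂)` occurring in `P` satisfies the system
`α₀+α₁+α₂ = 3(1+s)`, `α₁+2α₂ = 3s'`, `α₀+2α₁ = 3s''`, `2α₀+α₂ = 3s'''`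
for some nonnegative integers `s', s'', s'''`. -/
theorem stmt_3 (s : ℕ) (P : MvPolynomial (Fin 3) ℂ) (hH : Hinv3 P)
    (hhom : P.IsHomogeneous (3 * (1 + s))) :
    ∀ m ∈ P.support, ∃ s' s'' s''' : ℕ,
      m 0 + m 1 + m 2 = 3 * (1 + s) ∧
      m 1 + 2 * m 2 = 3 * s' ∧
      m 0 + 2 * m 1 = 3 * s'' ∧
      2 * m 0 + m 2 = 3 * s''' := by
  intro m hm
  have hc : coeff m P ≠ 0 := mem_support_iff.1 hm
  have hd : m 0 + m 1 + m 2 = 3 * (1 + s) := by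
    have h := hhom hc
    rwa [Finsupp.weight_apply, Finsupp.sum_fintype _ _ (by simp), Fin.sum_univ_three,
      Pi.one_apply, Pi.one_apply, Pi.one_apply, smul_eq_mul, smul_eq_mul, smul_eq_mul, mul_one,
      mul_one, mul_one] at h
  have h0 : tau3 (pderiv 0 P) = eps3 ^ 3 • pderiv 0 P := by simpa [jb3] using (hH 1 2).2
  have h1 : tau3 (pderiv 1 P) = eps3 ^ 2 • pderiv 1 P := by simpa [jb3] using (hH 2 0).2
  have h2 : tau3 (pderiv 2 P) = eps3 ^ 1 • pderiv 2 P := by simpa [jb3] using (hH 0 1).2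
  have hw : (m 1 + 2 * m 2) % 3 = 0 := by
    by_cases hm0 : m 0 = 0
    · by_cases hm1 : m 1 = 0
      · exact weight_modEq_of_tau3_pderiv h2 hc (by omega)
      · exact weight_modEq_of_tau3_pderiv h1 hc hm1
    · exact weight_modEq_of_tau3_pderiv h0 hc hm0
  exact ⟨(m 1 + 2 * m 2) / 3, (m 0 + 2 * m 1) / 3, (2 * m 0 + m 2) / 3, hd, by omega, by omega,
    by omega⟩
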